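/- Let n > 0 and let S ⊆ ℕ^ℕ be a subset of Baire space. If S is defined by a Σₙ (respectively Πₙ) sentence of L_Bor, i.e., there is a Σₙ (resp. Πₙ) sentence φ such that for every f : ℕ → ℕ one has f ∈ S iff M_f ⊨ φ, then S is Σ⁰ₙ (respectively Π⁰ₙ). -/

import Mathlib

/-- The index data of the symbols `ℓ_ι`, `τ_ι` of `L_Bor`: a function
`ι : ℕⁿ → ℕ^{<ℕ} ∖ {⟨⟩}` (with `n > 0`). -/
def BIota (n : ℕ) : Type := (Fin n → ℕ) → {l : List ℕ // l ≠ []}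

/-- Terms of the extended variadic language `L_Bor`: numeral constant symbols `𝐧`,
variables (indexed by `ℕ`), the unary function symbol `𝐟`, the `n`-ary function symbols
`ℓ_ι`, and the `n`-ary-by-variadic function symbols `τ_ι`, the latter forming terms
`τ_ι(u₁,…,uₙ,u(𝟎)⋯ₓu(v))`. -/
inductive BTerm : Type
  | const : ℕ → BTerm
  | var : ℕ → BTerm
  | fapp : BTerm → BTerm
  | len : {n : ℕ} → BIota (n + 1) → (Fin (n + 1) → BTerm) → BTerm
  | tau : {n : ℕ} → BIota (n + 1) → (Fin (n + 1) → BTerm) → BTerm → ℕ → BTerm → BTerm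

namespace BTerm

/-- The free variables of an `L_Bor` term. -/
def fv : BTerm → Set ℕ
  | const _ => ∅
  | var x => {x}
  | fapp u => u.fv
  | len _ ts => ⋃ i, (ts i).fv
  | tau _ ts u x v => (⋃ i, (ts i).fv) ∪ (u.fv \ {x}) ∪ v.fv

/-- Substitution of a term for a variable in an `L_Bor` term. -/
def subst : BTerm → ℕ → BTerm → BTerm
  | const c, _, _ => const c
  | var y, x, t => if y = x then t else var y
  | fapp u, x, t => fapp (u.subst x t)
  | len ι ts, x, t => len ι fun i => (ts i).subst x t
  | tau ι ts u y v, x, t =>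
      if y = x then tau ι (fun i => (ts i).subst x t) u y (v.subst x t)
      else tau ι (fun i => (ts i).subst x t) (u.subst x t) y (v.subst x t)

/-- The depth of an `L_Bor` term. -/
def depth : BTerm → ℕ
  | const _ => 0
  | var _ => 0
  | fapp u => u.depth + 1
  | len _ ts => (Finset.univ.sup fun i => (ts i).depth) + 1
  | tau _ ts u _ v =>
      max ((Finset.univ.sup fun i => (ts i).depth)) (max u.depth v.depth) + 1

lemma depth_subst_const (x : ℕ) (c : ℕ) :
    ∀ u : BTerm, (u.subst x (const c)).depth = u.depth
  | const _ => rfl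
  | var y => by by_cases h : y = x <;> simp [subst, h, depth]
  | fapp u => by simp [subst, depth, depth_subst_const x c u]
  | len ι ts => by
      simp only [subst, depth]
      congr 1
      exact Finset.sup_congr rfl fun i _ => depth_subst_const x c (ts i)
  | tau ι ts u y v => by
      by_cases h : y = x <;>
        simp only [subst, h, depth, if_true, if_false, depth_subst_const x c u,
          depth_subst_const x c v] <;>
      · congr 2
        exact Finset.sup_congr rfl fun i _ => depth_subst_const x c (ts i)

/-- The interpretation of an `L_Bor` term in the structure `M_f`, by an assignment `s`,
by recursion on term depth. -/
def interp (f : ℕ → ℕ) : BTerm → (ℕ → ℕ) → ℕ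
  | const c, _ => c
  | var x, s => s x
  | fapp u, s => f (u.interp f s)
  | len ι ts, s => (ι fun i => (ts i).interp f s).1.length - 1
  | tau ι ts u x v, s =>
      if ((List.range (v.interp f s + 1)).map fun k => (u.subst x (const k)).interp f s) =
          (ι fun i => (ts i).interp f s).1 then 1 else 0
termination_by t _ => t.depth
decreasing_by
  all_goals first
    | exact Nat.lt_succ_of_le (Nat.le_refl _)
    | exact Nat.lt_succ_of_le (Finset.le_sup (f := fun i => (ts i).depth) (Finset.mem_univ i))
    | exact Nat.lt_succ_of_le (le_trans (Finset.le_sup (f := fun i => (ts i).depth)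
        (Finset.mem_univ i)) (le_max_left _ _))
    | exact Nat.lt_succ_of_le (le_trans (le_max_right _ _) (le_max_right _ _))
    | (rw [BTerm.depth_subst_const];
       exact Nat.lt_succ_of_le (le_trans (le_max_left _ _) (le_max_right _ _)))

end BTerm

/-- Formulas of `L_Bor`. -/
inductive BFormula : Type
  | eq : BTerm → BTerm → BFormula
  | not : BFormula → BFormula
  | and : BFormula → BFormula → BFormula
  | or : BFormula → BFormula → BFormula
  | imp : BFormula → BFormula → BFormula
  | iff : BFormula → BFormula → BFormula
  | all : ℕ → BFormula → BFormula
  | ex : ℕ → BFormula → BFormula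

namespace BFormula

/-- The free variables of an `L_Bor` formula. -/
def fv : BFormula → Set ℕ
  | eq u v => u.fv ∪ v.fv
  | not φ => φ.fv
  | and φ ψ => φ.fv ∪ ψ.fv
  | or φ ψ => φ.fv ∪ ψ.fv
  | imp φ ψ => φ.fv ∪ ψ.fv
  | iff φ ψ => φ.fv ∪ ψ.fv
  | all y φ => φ.fv \ {y}
  | ex y φ => φ.fv \ {y}

/-- Quantifier-free `L_Bor` formulas. -/
inductive QF : BFormula → Prop
  | eq (u v : BTerm) : QF (.eq u v)
  | not {φ} : QF φ → QF (.not φ)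
  | and {φ ψ} : QF φ → QF ψ → QF (.and φ ψ)
  | or {φ ψ} : QF φ → QF ψ → QF (.or φ ψ)
  | imp {φ ψ} : QF φ → QF ψ → QF (.imp φ ψ)
  | iff {φ ψ} : QF φ → QF ψ → QF (.iff φ ψ)

end BFormula

/-- Satisfaction `M_f ⊨ φ[s]` of an `L_Bor` formula by an assignment. -/
def BSatisfies (f : ℕ → ℕ) (s : ℕ → ℕ) : BFormula → Prop
  | .eq u v => u.interp f s = v.interp f s
  | .not φ => ¬ BSatisfies f s φ
  | .and φ ψ => BSatisfies f s φ ∧ BSatisfies f s ψ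
  | .or φ ψ => BSatisfies f s φ ∨ BSatisfies f s ψ
  | .imp φ ψ => BSatisfies f s φ → BSatisfies f s ψ
  | .iff φ ψ => (BSatisfies f s φ ↔ BSatisfies f s ψ)
  | .all x φ => ∀ n : ℕ, BSatisfies f (Function.update s x n) φ
  | .ex x φ => ∃ n : ℕ, BSatisfies f (Function.update s x n) φ

/-- `M_f ⊨ φ`: satisfaction by every assignment. -/
def BModels (f : ℕ → ℕ) (φ : BFormula) : Prop := ∀ s : ℕ → ℕ, BSatisfies f s φ

mutual
/-- `Σₙ` prenex formulas of `L_Bor`: `n` alternating blocks of quantifiers beginning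
with existentials, followed by a quantifier-free formula (blocks may be empty). -/
inductive SigmaFml : ℕ → BFormula → Prop
  | ofQF {φ} : BFormula.QF φ → SigmaFml 0 φ
  | ofPi {n φ} : PiFml n φ → SigmaFml (n + 1) φ
  | ex {n} (x : ℕ) {φ} : SigmaFml (n + 1) φ → SigmaFml (n + 1) (.ex x φ)

/-- `Πₙ` prenex formulas of `L_Bor`: `n` alternating blocks of quantifiers beginning
with universals, followed by a quantifier-free formula (blocks may be empty). -/
inductive PiFml : ℕ → BFormula → Prop
  | ofQF {φ} : BFormula.QF φ → PiFml 0 φ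
  | ofSigma {n φ} : SigmaFml n φ → PiFml (n + 1) φ
  | all {n} (x : ℕ) {φ} : PiFml (n + 1) φ → PiFml (n + 1) (.all x φ)
end

/-- The finite Borel hierarchy on Baire space: `Σ⁰₁` sets are the open sets, and
`Σ⁰ₙ₊₁` sets are countable unions of `Π⁰ₙ` sets, where a set is `Π⁰ₙ` iff its
complement is `Σ⁰ₙ`. -/
def SigmaPt : ℕ → Set (ℕ → ℕ) → Prop
  | 0, _ => False
  | 1, S => IsOpen S
  | (n + 2), S =>
      ∃ A : ℕ → Set (ℕ → ℕ), (∀ i, SigmaPt (n + 1) (A i)ᶜ) ∧ S = ⋃ i, A i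

/-- A set is `Π⁰ₙ` iff its complement is `Σ⁰ₙ`. -/
def PiPt (n : ℕ) (S : Set (ℕ → ℕ)) : Prop := SigmaPt n Sᶜ

open Filter Topology

namespace BTerm

theorem interp_subst_const (f : ℕ → ℕ) (u : BTerm) (x k : ℕ) (s : ℕ → ℕ) :
    (u.subst x (const k)).interp f s = u.interp f (Function.update s x k) := by
  induction hd : u.depth using Nat.strong_induction_on generalizing u x k s with
  | _ d ih =>
    subst hd
    cases u with
    | const c => simp [subst, interp]
    | var y =>
      by_cases h : y = x
      · subst h
        simp [subst, interp]
      · simp [subst, interp, h]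
    | fapp u =>
      simp only [subst, interp]
      rw [ih _ (by simp [depth]) u x k s rfl]
    | len ι ts =>
      have hts : ∀ i, ((ts i).subst x (const k)).interp f s =
          (ts i).interp f (Function.update s x k) := fun i =>
        ih _ (Nat.lt_succ_of_le (Finset.le_sup (f := fun i => (ts i).depth)
          (Finset.mem_univ i))) (ts i) x k s rfl
      simp only [subst, interp, hts]
    | tau ι ts u y v =>
      have hts : ∀ i, ((ts i).subst x (const k)).interp f s =
          (ts i).interp f (Function.update s x k) := fun i =>
        ih _ (Nat.lt_succ_of_le (le_trans (Finset.le_sup (f := fun i => (ts i).depth)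
          (Finset.mem_univ i)) (le_max_left _ _))) (ts i) x k s rfl
      have hv := ih v.depth
        (Nat.lt_succ_of_le (le_trans (le_max_right _ _) (le_max_right _ _))) v x k s rfl
      have hu : u.depth < (tau ι ts u y v).depth :=
        Nat.lt_succ_of_le (le_trans (le_max_left _ _) (le_max_right _ _))
      by_cases h : y = x
      · subst h
        simp only [subst, if_true, interp, hts, hv, ih _ hu u _ _ _ rfl, Function.update_idem]
      · have hu' : (u.subst x (const k)).depth < (tau ι ts u y v).depth := by
          rwa [depth_subst_const]
        simp only [subst, if_neg h, interp, hts, hv, ih _ hu u _ _ _ rfl,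
          ih _ hu' (u.subst x (const k)) _ _ _ rfl, Function.update_comm h]

theorem interp_tau (f : ℕ → ℕ) {n : ℕ} (ι : BIota (n + 1)) (ts : Fin (n + 1) → BTerm)
    (u : BTerm) (x : ℕ) (v : BTerm) (s : ℕ → ℕ) :
    (tau ι ts u x v).interp f s =
      if ((List.range (v.interp f s + 1)).map fun k => u.interp f (Function.update s x k)) =
        (ι fun i => (ts i).interp f s).1 then 1 else 0 := by
  simp only [interp, interp_subst_const]

/-- The interpretation of a term depends only on the values of its free variables. -/
theorem interp_congr (f : ℕ → ℕ) (u : BTerm) {s t : ℕ → ℕ} (h : Set.EqOn s t u.fv) :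
    u.interp f s = u.interp f t := by
  induction u generalizing s t with
  | const c => simp [interp]
  | var y => simpa [interp] using h (Set.mem_singleton y)
  | fapp u ih =>
    simp only [interp]
    rw [ih h]
  | len ι ts ih =>
    have hts : ∀ i, (ts i).interp f s = (ts i).interp f t := fun i =>
      ih i (h.mono (Set.subset_iUnion (fun i => (ts i).fv) i))
    simp only [interp, hts]
  | tau ι ts u x v ihts ihu ihv =>
    have hts : ∀ i, (ts i).interp f s = (ts i).interp f t := fun i =>
      ihts i fun y hy => h (Or.inl (Or.inl (Set.mem_iUnion.2 ⟨i, hy⟩)))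
    have hv : v.interp f s = v.interp f t := ihv fun y hy => h (Or.inr hy)
    have hu : ∀ k, u.interp f (Function.update s x k) = u.interp f (Function.update t x k) := by
      refine fun k => ihu fun y hy => ?_
      by_cases hyx : y = x
      · simp [hyx]
      · simpa [hyx] using h (Or.inl (Or.inr ⟨hy, hyx⟩))
    simp only [interp_tau, hts, hv, hu]

/-- The interpretation of a term is a locally constant function on Baire space. -/
theorem eventually_interp_eq (u : BTerm) (s f : ℕ → ℕ) :
    ∀ᶠ g in 𝓝 f, u.interp g s = u.interp f s := by
  induction u generalizing s with
  | const c => simp [interp]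
  | var y => simp [interp]
  | fapp u ih =>
    have hf : ∀ᶠ g in 𝓝 f, g (u.interp f s) = f (u.interp f s) :=
      (continuous_apply (u.interp f s)).continuousAt.eventually_mem
        ((isOpen_discrete {f (u.interp f s)}).mem_nhds rfl)
    filter_upwards [ih s, hf] with g hg hgf
    simp only [interp, hg, hgf]
  | len ι ts ih =>
    filter_upwards [eventually_all.2 fun i => ih i s] with g hg
    simp only [interp, hg]
  | tau ι ts u x v ihts ihu ihv =>
    have hu : ∀ᶠ g in 𝓝 f, ∀ k ∈ Finset.range (v.interp f s + 1),
        u.interp g (Function.update s x k) = u.interp f (Function.update s x k) :=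
      (eventually_all_finset _).2 fun k _ => ihu _
    filter_upwards [eventually_all.2 fun i => ihts i s, ihv s, hu] with g hts hv hu
    have hmap : ((List.range (v.interp f s + 1)).map fun k => u.interp g (Function.update s x k)) =
        (List.range (v.interp f s + 1)).map fun k => u.interp f (Function.update s x k) :=
      List.map_congr_left fun k hk => hu k (by simpa using hk)
    simp only [interp_tau, hts, hv, hmap]

end BTerm

/-- Satisfaction of a formula depends only on the values of its free variables. -/
theorem bSatisfies_congr (f : ℕ → ℕ) (φ : BFormula) {s t : ℕ → ℕ} (h : Set.EqOn s t φ.fv) :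
    BSatisfies f s φ ↔ BSatisfies f t φ := by
  have update_eqOn : ∀ {A : Set ℕ} {s t : ℕ → ℕ} {x : ℕ}, Set.EqOn s t (A \ {x}) →
      ∀ k, Set.EqOn (Function.update s x k) (Function.update t x k) A := by
    intro A s t x h k y hy
    by_cases hyx : y = x
    · simp [hyx]
    · simpa [hyx] using h ⟨hy, hyx⟩
  induction φ generalizing s t with
  | eq u v =>
    simp only [BSatisfies]
    rw [u.interp_congr f (h.mono Set.subset_union_left),
      v.interp_congr f (h.mono Set.subset_union_right)]
  | not φ ih => exact not_congr (ih h)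
  | and φ ψ ih₁ ih₂ =>
    exact and_congr (ih₁ (h.mono Set.subset_union_left)) (ih₂ (h.mono Set.subset_union_right))
  | or φ ψ ih₁ ih₂ =>
    exact or_congr (ih₁ (h.mono Set.subset_union_left)) (ih₂ (h.mono Set.subset_union_right))
  | imp φ ψ ih₁ ih₂ =>
    exact imp_congr (ih₁ (h.mono Set.subset_union_left)) (ih₂ (h.mono Set.subset_union_right))
  | iff φ ψ ih₁ ih₂ =>
    exact iff_congr (ih₁ (h.mono Set.subset_union_left)) (ih₂ (h.mono Set.subset_union_right))
  | all x φ ih => exact forall_congr' fun k => ih (update_eqOn h k)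
  | ex x φ ih => exact exists_congr fun k => ih (update_eqOn h k)

theorem BFormula.QF.eventually_bSatisfies_iff {φ : BFormula} (hφ : φ.QF) (s f : ℕ → ℕ) :
    ∀ᶠ g in 𝓝 f, (BSatisfies g s φ ↔ BSatisfies f s φ) := by
  induction hφ with
  | eq u v =>
    filter_upwards [u.eventually_interp_eq s f, v.eventually_interp_eq s f] with g hu hv
    simp only [BSatisfies, hu, hv]
  | not _ ih =>
    filter_upwards [ih] with g h
    exact not_congr h
  | and _ _ ih₁ ih₂ =>
    filter_upwards [ih₁, ih₂] with g h₁ h₂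
    exact and_congr h₁ h₂
  | or _ _ ih₁ ih₂ =>
    filter_upwards [ih₁, ih₂] with g h₁ h₂
    exact or_congr h₁ h₂
  | imp _ _ ih₁ ih₂ =>
    filter_upwards [ih₁, ih₂] with g h₁ h₂
    exact imp_congr h₁ h₂
  | iff _ _ ih₁ ih₂ =>
    filter_upwards [ih₁, ih₂] with g h₁ h₂
    exact iff_congr h₁ h₂

theorem BFormula.QF.isOpen_setOf_bSatisfies {φ : BFormula} (hφ : φ.QF) (s : ℕ → ℕ) :
    IsOpen {f | BSatisfies f s φ} :=
  isOpen_iff_mem_nhds.2 fun f hf => by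
    filter_upwards [hφ.eventually_bSatisfies_iff s f] with g hg
    exact hg.2 hf

/-- The class `Σ⁰ₙ₊₁` is closed under countable unions. -/
theorem SigmaPt.iUnion {n : ℕ} {B : ℕ → Set (ℕ → ℕ)} (h : ∀ i, SigmaPt (n + 1) (B i)) :
    SigmaPt (n + 1) (⋃ i, B i) := by
  cases n with
  | zero => exact isOpen_iUnion h
  | succ n =>
    choose A hA hB using h
    refine ⟨fun k => A k.unpair.1 k.unpair.2, fun k => hA _ _, ?_⟩
    rw [Set.iUnion_unpair A]
    exact Set.iUnion_congr hB

theorem PiPt.sigmaPt_succ {n : ℕ} {S : Set (ℕ → ℕ)} (h : PiPt (n + 1) S) :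
    SigmaPt (n + 2) S :=
  ⟨fun _ => S, fun _ => h, (Set.iUnion_const S).symm⟩

theorem SigmaPt.piPt_succ {n : ℕ} {S : Set (ℕ → ℕ)} (h : SigmaPt (n + 1) S) :
    PiPt (n + 2) S :=
  PiPt.sigmaPt_succ (by rwa [PiPt, compl_compl])

mutual

theorem SigmaFml.sigmaPt_setOf_bSatisfies {n : ℕ} {φ : BFormula} (hφ : SigmaFml n φ)
    (hn : 0 < n) (s : ℕ → ℕ) : SigmaPt n {f | BSatisfies f s φ} := by
  match n, φ, hφ with
  | _, _, .ofQF _ => exact absurd hn (lt_irrefl 0)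
  | 1, _, .ofPi (.ofQF h) => exact h.isOpen_setOf_bSatisfies s
  | _ + 2, _, .ofPi h => exact (h.piPt_setOf_bSatisfies (Nat.succ_pos _) s).sigmaPt_succ
  | _ + 1, _, .ex x h =>
    have hU := SigmaPt.iUnion fun k => h.sigmaPt_setOf_bSatisfies hn (Function.update s x k)
    simpa only [BSatisfies, ← Set.ofPred_exists] using hU

theorem PiFml.piPt_setOf_bSatisfies {n : ℕ} {φ : BFormula} (hφ : PiFml n φ)
    (hn : 0 < n) (s : ℕ → ℕ) : PiPt n {f | BSatisfies f s φ} := by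
  match n, φ, hφ with
  | _, _, .ofQF _ => exact absurd hn (lt_irrefl 0)
  | 1, _, .ofSigma (.ofQF h) => exact h.not.isOpen_setOf_bSatisfies s
  | _ + 2, _, .ofSigma h => exact (h.sigmaPt_setOf_bSatisfies (Nat.succ_pos _) s).piPt_succ
  | _ + 1, _, .all x h =>
    have hU := SigmaPt.iUnion fun k => h.piPt_setOf_bSatisfies hn (Function.update s x k)
    rw [← Set.compl_iInter] at hU
    simpa only [PiPt, BSatisfies, ← Set.ofPred_forall] using hU

end

theorem bModels_iff_bSatisfies {φ : BFormula} (hφ : φ.fv = ∅) (f s : ℕ → ℕ) :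
    BModels f φ ↔ BSatisfies f s φ :=
  ⟨fun h => h s, fun h _ => (bSatisfies_congr f φ (by simp [hφ])).1 h⟩

/-- If `S ⊆ ℕ^ℕ` is defined by a `Σₙ` (resp. `Πₙ`) sentence of `L_Bor` for `n > 0`, then
`S` is `Σ⁰ₙ` (resp. `Π⁰ₙ`). -/
theorem sentence_defined_is_borel (n : ℕ) (hn : 0 < n) (S : Set (ℕ → ℕ)) :
    (∀ φ : BFormula, SigmaFml n φ → φ.fv = ∅ →
        (∀ f : ℕ → ℕ, f ∈ S ↔ BModels f φ) → SigmaPt n S) ∧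
    (∀ φ : BFormula, PiFml n φ → φ.fv = ∅ →
        (∀ f : ℕ → ℕ, f ∈ S ↔ BModels f φ) → PiPt n S) := by
  have hS : ∀ φ : BFormula, φ.fv = ∅ → (∀ f : ℕ → ℕ, f ∈ S ↔ BModels f φ) →
      S = {f | BSatisfies f 0 φ} := fun φ hφ h =>
    Set.ext fun f => (h f).trans (bModels_iff_bSatisfies hφ f 0)
  refine ⟨fun φ hφ hfv h => ?_, fun φ hφ hfv h => ?_⟩
  · rw [hS φ hfv h]
    exact hφ.sigmaPt_setOf_bSatisfies hn 0
  · rw [hS φ hfv h]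
    exact hφ.piPt_setOf_bSatisfies hn 0
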